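/- In UT_3(F) with the involution A* = J·Aᵀ·J, for any x₁,...,x₅ each symmetric or skew-symmetric, the identity [[x₁,x₂],x₅][x₃,x₄] = (-1)^{|x₅|}[x₁,x₂][[x₃,x₄],x₅] holds, where |x₅| = 1 if x₅ is symmetric and 0 otherwise. -/

import Mathlib

open Matrix

/-- The anti-diagonal 3×3 permutation matrix `J`. -/
noncomputable def J3 (F : Type*) [Field F] : Matrix (Fin 3) (Fin 3) F :=
  Matrix.of fun i j => if (i : ℕ) + (j : ℕ) = 2 then 1 else 0

/-- The involution `A ↦ J·Aᵀ·J` on `UT₃(F)`. -/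
noncomputable def st3 {F : Type*} [Field F] (A : Matrix (Fin 3) (Fin 3) F) :
    Matrix (Fin 3) (Fin 3) F :=
  J3 F * Aᵀ * J3 F

/-- `A` is upper triangular. -/
def UT3 {F : Type*} [Field F] (A : Matrix (Fin 3) (Fin 3) F) : Prop :=
  ∀ i j : Fin 3, (j : ℕ) < (i : ℕ) → A i j = 0

/-- commutator -/
def cm {F : Type*} [Field F] (a b : Matrix (Fin 3) (Fin 3) F) : Matrix (Fin 3) (Fin 3) F :=
  a * b - b * a

/-- `x` is symmetric or skew-symmetric, with sign `e = (-1)^{|x|}`: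
`e = -1` if `x` is symmetric (`|x| = 1`), `e = 1` if `x` is skew-symmetric (`|x| = 0`). -/
def sgn3 {F : Type*} [Field F] (x : Matrix (Fin 3) (Fin 3) F) (e : F) : Prop :=
  (st3 x = x ∧ e = -1) ∨ (st3 x = -x ∧ e = 1)

theorem st3_apply {F : Type*} [Field F] (A : Matrix (Fin 3) (Fin 3) F) (i j : Fin 3) :
    st3 A i j = A j.rev i.rev := by
  fin_cases i <;> fin_cases j <;> simp [st3, J3, Matrix.mul_apply, Fin.sum_univ_three, Fin.rev]

theorem UT3.cm_apply_eq_zero {F : Type*} [Field F] {a b : Matrix (Fin 3) (Fin 3) F}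
    (ha : UT3 a) (hb : UT3 b) {i j : Fin 3} (hij : j ≤ i) : cm a b i j = 0 := by
  have a10 := ha 1 0 (by decide)
  have a20 := ha 2 0 (by decide)
  have a21 := ha 2 1 (by decide)
  have b10 := hb 1 0 (by decide)
  have b20 := hb 2 0 (by decide)
  have b21 := hb 2 1 (by decide)
  fin_cases i <;> fin_cases j <;>
    simp_all [cm, Matrix.mul_apply, Fin.sum_univ_three, mul_comm]

/-- The diagonal of a symmetric or skew-symmetric matrix is determined by its sign. -/
theorem sgn3.diag_sub {F : Type*} [Field F] (h2 : (2 : F) ≠ 0) {x : Matrix (Fin 3) (Fin 3) F}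
    {e : F} (h : sgn3 x e) : x 1 1 - x 0 0 = e * (x 2 2 - x 1 1) := by
  obtain ⟨h, rfl⟩ | ⟨h, rfl⟩ := h
  · have h0 : x 2 2 = x 0 0 := by simpa [st3_apply] using congrFun₂ h 0 0
    rw [h0]
    ring
  · have h0 : x 2 2 = -x 0 0 := by simpa [st3_apply] using congrFun₂ h 0 0
    have h1 : x 1 1 = -x 1 1 := by simpa [st3_apply] using congrFun₂ h 1 1
    have h1' : x 1 1 = 0 :=
      (mul_eq_zero.mp (by linear_combination h1 : 2 * x 1 1 = 0)).resolve_left h2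
    rw [h0, h1']
    ring

theorem cm_mul_eq_smul_mul_cm {F : Type*} [Field F] {c d x : Matrix (Fin 3) (Fin 3) F} {e : F}
    (hc : ∀ {i j : Fin 3}, j ≤ i → c i j = 0) (hd : ∀ {i j : Fin 3}, j ≤ i → d i j = 0)
    (hx : UT3 x) (hdiag : x 1 1 - x 0 0 = e * (x 2 2 - x 1 1)) :
    cm c x * d = e • (c * cm d x) := by
  have x10 := hx 1 0 (by decide)
  have x20 := hx 2 0 (by decide)
  have x21 := hx 2 1 (by decide)
  have c00 := hc (i := 0) (j := 0) (by decide)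
  have c10 := hc (i := 1) (j := 0) (by decide)
  have c11 := hc (i := 1) (j := 1) (by decide)
  have c20 := hc (i := 2) (j := 0) (by decide)
  have c21 := hc (i := 2) (j := 1) (by decide)
  have c22 := hc (i := 2) (j := 2) (by decide)
  have d00 := hd (i := 0) (j := 0) (by decide)
  have d10 := hd (i := 1) (j := 0) (by decide)
  have d11 := hd (i := 1) (j := 1) (by decide)
  have d20 := hd (i := 2) (j := 0) (by decide)
  have d21 := hd (i := 2) (j := 1) (by decide)
  have d22 := hd (i := 2) (j := 2) (by decide)
  ext i j
  fin_cases i <;> fin_cases j <;>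
    simp [cm, Matrix.mul_apply, Fin.sum_univ_three, x10, x20, x21, c00, c10, c11, c20, c21, c22,
      d00, d10, d11, d20, d21, d22]
  linear_combination c 0 1 * d 1 2 * hdiag

theorem stmt9 (F : Type*) [Field F] (h2 : (2 : F) ≠ 0)
    (x1 x2 x3 x4 x5 : Matrix (Fin 3) (Fin 3) F) (e5 : F)
    (u1 : UT3 x1) (u2 : UT3 x2) (u3 : UT3 x3) (u4 : UT3 x4) (u5 : UT3 x5)
    (hs1 : st3 x1 = x1 ∨ st3 x1 = -x1) (hs2 : st3 x2 = x2 ∨ st3 x2 = -x2)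
    (hs3 : st3 x3 = x3 ∨ st3 x3 = -x3) (hs4 : st3 x4 = x4 ∨ st3 x4 = -x4)
    (hs5 : sgn3 x5 e5) :
    cm (cm x1 x2) x5 * cm x3 x4 = e5 • (cm x1 x2 * cm (cm x3 x4) x5) := by
  exact cm_mul_eq_smul_mul_cm (u1.cm_apply_eq_zero u2) (u3.cm_apply_eq_zero u4) u5
    (hs5.diag_sub h2)
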